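/- arXiv:math/0006202 — 2 statements merged into one kernel-verified Lean document; each statement's English description precedes it below -/
import Mathlib

section
/- The Krammer matrices define a representation of B_n: the R-linear maps on the free module V with basis {x_{i,j}}_{1≤i<j≤n} given by Krammer's explicit formulas for the action of σ_k on x_{i,j} (seven cases depending on the relative position of k to i, j) are invertible and satisfy the braid relations σ_kσ_l = σ_lσ_k for |k-l| ≥ 2 and σ_kσ_{k+1}σ_k = σ_{k+1}σ_kσ_{k+1}; hence they define a group homomorphism B_n → GL(V). -/
def braidRels (n : ℕ) : Set (FreeGroup (Fin n)) :=
  {r | (∃ i j : Fin n, (i : ℕ) + 2 ≤ (j : ℕ) ∧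
          r = .of i * .of j * (.of i)⁻¹ * (.of j)⁻¹) ∨
       (∃ i j : Fin n, (j : ℕ) = (i : ℕ) + 1 ∧
          r = .of i * .of j * .of i * (.of j * .of i * .of j)⁻¹)}

abbrev BraidGroup (n : ℕ) : Type := PresentedGroup (braidRels n)

/-- The index set `Ref` of pairs `(i,j)` with `1 ≤ i < j ≤ n`. -/
def Ref (n : ℕ) : Type := {p : ℕ × ℕ // 1 ≤ p.1 ∧ p.1 < p.2 ∧ p.2 ≤ n}

instance (n : ℕ) : DecidableEq (Ref n) := fun a b =>
  decidable_of_iff (a.val = b.val) Subtype.ext_iff.symm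

/-- The coefficient at the basis vector `x_{(a,b)}` of the image `σ_k (x_{i,j})` under
Krammer's explicit formulas (seven cases according to the relative position of `k` and
`(i,j)`). The argument `p = (a,b)` is the target index. -/
def krammerCoeff {R : Type*} [CommRing R] (q t : R) (k i j : ℕ) (p : ℕ × ℕ) : R :=
  if k + 1 < i ∨ j < k then (if p = (i, j) then 1 else 0)
  else if i = k + 1 then (if p = (k, j) then 1 else if p = (i, j) then 1 - q else 0)
  else if k = i ∧ i + 1 < j then
    (if p = (i, i + 1) then t * q * (q - 1) else if p = (i + 1, j) then q else 0)
  else if k = i ∧ j = i + 1 then (if p = (i, j) then t * q ^ 2 else 0)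
  else if i < k ∧ k + 1 < j then
    (if p = (i, j) then 1 else if p = (k, k + 1) then t * q ^ (k - i) * (q - 1) ^ 2 else 0)
  else if k + 1 = j then
    (if p = (i, k) then 1 else if p = (k, j) then t * q ^ (j - i) * (q - 1) else 0)
  else (if p = (i, j) then 1 - q else if p = (i, j + 1) then q else 0)

instance (n : ℕ) : Finite (Ref n) :=
  Finite.of_injective
    (fun s : Ref n => ((⟨s.val.1, by have := s.property; omega⟩,
      ⟨s.val.2, by have := s.property; omega⟩) : Fin (n + 1) × Fin (n + 1)))
    (fun a b h => by
      simp only [Prod.mk.injEq, Fin.mk.injEq] at h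
      exact Subtype.ext (Prod.ext h.1 h.2))

namespace Krammer

variable {R : Type*} [CommRing R]

/-- The vector `x_{i,j}`, which is zero when `(i,j)` is not an index. -/
def vec (R : Type*) [CommRing R] (N i j : ℕ) : Ref N → R :=
  fun r => if r.val = (i, j) then 1 else 0

/-- The linear map `σ_k` given by Krammer's formulas. -/
noncomputable def sigma (N : ℕ) (q t : R) (k : ℕ) : (Ref N → R) →ₗ[R] (Ref N → R) :=
  (Pi.basisFun R (Ref N)).constr R
    (fun s r => krammerCoeff q t k s.val.1 s.val.2 r.val)

theorem sigma_single {N : ℕ} (q t : R) (k : ℕ) (s : Ref N) :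
    sigma N q t k (Pi.single s 1) =
      fun r => krammerCoeff q t k s.val.1 s.val.2 r.val := by
  rw [← Pi.basisFun_apply, sigma, Module.Basis.constr_basis]

theorem single_eq_vec {N : ℕ} (s : Ref N) :
    (Pi.single s 1 : Ref N → R) = vec R N s.val.1 s.val.2 := by
  ext r
  have h : r = s ↔ r.val = s.val := Subtype.ext_iff
  simp only [Pi.single_apply, vec, Prod.mk.eta, h]

theorem sigma_vec {N : ℕ} (q t : R) (k : ℕ) {i j : ℕ} (hi : 1 ≤ i) (hij : i < j) (hj : j ≤ N) :
    sigma N q t k (vec R N i j) = fun r => krammerCoeff q t k i j r.val := by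
  obtain ⟨s, hs⟩ : ∃ s : Ref N, s.val = (i, j) := ⟨⟨(i, j), hi, hij, hj⟩, rfl⟩
  simpa only [single_eq_vec, hs] using sigma_single q t k s

variable {N : ℕ} (q t : R)

theorem sigma_vec_of_outside {k i j : ℕ} (h : k + 1 < i ∨ j < k) (hi : 1 ≤ i) (hij : i < j)
    (hj : j ≤ N) : sigma N q t k (vec R N i j) = vec R N i j := by
  rw [sigma_vec q t k hi hij hj]
  ext r
  simp only [krammerCoeff, vec, if_pos h]

theorem sigma_vec_succ_left {k j : ℕ} (hij : k + 1 < j) (hj : j ≤ N) :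
    sigma N q t k (vec R N (k + 1) j) = vec R N k j + (1 - q) • vec R N (k + 1) j := by
  rw [sigma_vec q t k (by omega) hij hj]
  ext r
  simp only [krammerCoeff, vec, Pi.add_apply, Pi.smul_apply, smul_eq_mul]
  obtain ⟨a, b⟩ := r.val
  simp only [Prod.mk.injEq]
  split_ifs <;> first | omega | simp

theorem sigma_vec_left {k j : ℕ} (hi : 1 ≤ k) (hij : k + 1 < j) (hj : j ≤ N) :
    sigma N q t k (vec R N k j) =
      (t * q * (q - 1)) • vec R N k (k + 1) + q • vec R N (k + 1) j := by
  rw [sigma_vec q t k hi (by omega) hj]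
  ext r
  simp only [krammerCoeff, vec, Pi.add_apply, Pi.smul_apply, smul_eq_mul]
  obtain ⟨a, b⟩ := r.val
  simp only [Prod.mk.injEq, true_and]
  split_ifs <;> first | omega | simp

theorem sigma_vec_self {k : ℕ} (hi : 1 ≤ k) (hj : k + 1 ≤ N) :
    sigma N q t k (vec R N k (k + 1)) = (t * q ^ 2) • vec R N k (k + 1) := by
  rw [sigma_vec q t k hi (by omega) hj]
  ext r
  simp only [krammerCoeff, vec, Pi.smul_apply, smul_eq_mul]
  obtain ⟨a, b⟩ := r.val
  simp only [Prod.mk.injEq, true_and, and_self]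
  split_ifs <;> first | omega | simp

theorem sigma_vec_of_inside {k i j : ℕ} (hi : 1 ≤ i) (hik : i < k) (hkj : k + 1 < j)
    (hj : j ≤ N) :
    sigma N q t k (vec R N i j) =
      vec R N i j + (t * q ^ (k - i) * (q - 1) ^ 2) • vec R N k (k + 1) := by
  rw [sigma_vec q t k hi (by omega) hj]
  ext r
  simp only [krammerCoeff, vec, Pi.add_apply, Pi.smul_apply, smul_eq_mul]
  obtain ⟨a, b⟩ := r.val
  simp only [Prod.mk.injEq]
  split_ifs <;> first | omega | simp

theorem sigma_vec_succ_right {k i : ℕ} (hi : 1 ≤ i) (hik : i < k) (hj : k + 1 ≤ N) :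
    sigma N q t k (vec R N i (k + 1)) =
      vec R N i k + (t * q ^ (k - i + 1) * (q - 1)) • vec R N k (k + 1) := by
  rw [sigma_vec q t k hi (by omega) hj, show k - i + 1 = k + 1 - i by omega]
  ext r
  simp only [krammerCoeff, vec, Pi.add_apply, Pi.smul_apply, smul_eq_mul]
  obtain ⟨a, b⟩ := r.val
  simp only [Prod.mk.injEq]
  split_ifs <;> first | omega | simp

theorem sigma_vec_right {k i : ℕ} (hi : 1 ≤ i) (hik : i < k) (hj : k ≤ N) :
    sigma N q t k (vec R N i k) = (1 - q) • vec R N i k + q • vec R N i (k + 1) := by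
  rw [sigma_vec q t k hi hik hj]
  ext r
  simp only [krammerCoeff, vec, Pi.add_apply, Pi.smul_apply, smul_eq_mul]
  obtain ⟨a, b⟩ := r.val
  simp only [Prod.mk.injEq]
  split_ifs <;> first | omega | simp

theorem linearMap_ext {f g : (Ref N → R) →ₗ[R] (Ref N → R)}
    (h : ∀ i j, 1 ≤ i → i < j → j ≤ N → f (vec R N i j) = g (vec R N i j)) : f = g := by
  refine (Pi.basisFun R (Ref N)).ext fun s => ?_
  rw [Pi.basisFun_apply, single_eq_vec]
  exact h _ _ s.property.1 s.property.2.1 s.property.2.2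

theorem sigma_comm {k l : ℕ} (hk : 1 ≤ k) (hkl : k + 2 ≤ l) (hl : l + 1 ≤ N) :
    sigma N q t k * sigma N q t l = sigma N q t l * sigma N q t k := by
  refine linearMap_ext fun i j hi hij hj => ?_
  simp only [Module.End.mul_apply]
  have hlk : l - k = l - (k + 1) + 1 := by omega
  rcases (by omega : i < k ∨ k = i ∨ i = k + 1 ∨ (k + 1 < i ∧ i < l) ∨ l = i ∨ i = l + 1 ∨
    l + 1 < i) with h | rfl | rfl | h | rfl | rfl | h <;>
  rcases (by omega : j < k ∨ k = j ∨ j = k + 1 ∨ (k + 1 < j ∧ j < l) ∨ l = j ∨ j = l + 1 ∨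
    l + 1 < j) with h' | rfl | rfl | h' | rfl | rfl | h' <;>
  first
  | omega
  | (simp (disch := omega) only [map_add, map_smul, sigma_vec_of_outside, sigma_vec_succ_left,
      sigma_vec_left, sigma_vec_self, sigma_vec_of_inside, sigma_vec_succ_right, sigma_vec_right]
     try simp only [hlk]
     try module)

theorem sigma_braid {k : ℕ} (hk : 1 ≤ k) (hl : k + 1 + 1 ≤ N) :
    sigma N q t k * sigma N q t (k + 1) * sigma N q t k =
      sigma N q t (k + 1) * sigma N q t k * sigma N q t (k + 1) := by
  refine linearMap_ext fun i j hi hij hj => ?_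
  simp only [Module.End.mul_apply]
  rcases (by omega : i < k ∨ k = i ∨ i = k + 1 ∨ i = k + 1 + 1 ∨ k + 1 + 1 < i)
    with h | rfl | rfl | rfl | h <;>
  rcases (by omega : j < k ∨ k = j ∨ j = k + 1 ∨ j = k + 1 + 1 ∨ k + 1 + 1 < j)
    with h' | rfl | rfl | rfl | h' <;>
  first
  | omega
  | (try have hki : k + 1 - i = k - i + 1 := by omega
     simp (disch := omega) only [map_add, map_smul, sigma_vec_of_outside, sigma_vec_succ_left,
      sigma_vec_left, sigma_vec_self, sigma_vec_of_inside, sigma_vec_succ_right, sigma_vec_right,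
      Nat.add_sub_cancel_left]
     try simp only [hki]
     try module)

theorem isUnit_sigma {q t : R} (hq : IsUnit q) (ht : IsUnit t) {k : ℕ} (hk : 1 ≤ k)
    (hkN : k + 1 ≤ N) : IsUnit (sigma N q t k) := by
  rw [Module.End.isUnit_iff]
  suffices hs : Function.Surjective (sigma N q t k) from
    ⟨OrzechProperty.injective_of_surjective_endomorphism _ hs, hs⟩
  rw [← LinearMap.range_eq_top]
  set S := LinearMap.range (sigma N q t k)
  have mem (v) : sigma N q t k v ∈ S := LinearMap.mem_range_self _ v
  have cancel {u : R} (hu : IsUnit u) {v : Ref N → R} (h : u • v ∈ S) : v ∈ S :=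
    (S.smul_mem_iff_of_isUnit hu).1 h
  have hself : vec R N k (k + 1) ∈ S := by
    have h := mem (vec R N k (k + 1))
    rw [sigma_vec_self q t hk hkN] at h
    exact cancel (ht.mul (hq.pow 2)) h
  have hsl {j} (hj : k + 1 < j) (hjN : j ≤ N) : vec R N (k + 1) j ∈ S := by
    have h := mem (vec R N k j)
    rw [sigma_vec_left q t hk hj hjN] at h
    exact cancel hq ((S.add_mem_iff_right (S.smul_mem _ hself)).1 h)
  have hr {i} (hi : 1 ≤ i) (hik : i < k) : vec R N i k ∈ S := by
    have h := mem (vec R N i (k + 1))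
    rw [sigma_vec_succ_right q t hi hik hkN] at h
    exact (S.add_mem_iff_left (S.smul_mem _ hself)).1 h
  have hall (i j) (hi : 1 ≤ i) (hij : i < j) (hj : j ≤ N) : vec R N i j ∈ S := by
    have h := mem (vec R N i j)
    rcases (by omega : (k + 1 < i ∨ j < k) ∨ i = k + 1 ∨ (i = k ∧ k + 1 < j) ∨
      (i = k ∧ j = k + 1) ∨ (i < k ∧ k + 1 < j) ∨ (i < k ∧ j = k + 1) ∨ (i < k ∧ j = k))
      with h' | rfl | ⟨rfl, h'⟩ | ⟨rfl, rfl⟩ | ⟨h', h''⟩ | ⟨h', rfl⟩ | ⟨h', rfl⟩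
    · rwa [sigma_vec_of_outside q t h' hi hij hj] at h
    · exact hsl hij hj
    · have h := mem (vec R N (i + 1) j)
      rw [sigma_vec_succ_left q t h' hj] at h
      exact (S.add_mem_iff_left (S.smul_mem _ (hsl h' hj))).1 h
    · exact hself
    · rw [sigma_vec_of_inside q t hi h' h'' hj] at h
      exact (S.add_mem_iff_left (S.smul_mem _ hself)).1 h
    · have h := mem (vec R N i k)
      rw [sigma_vec_right q t hi h' (by omega)] at h
      exact cancel hq ((S.add_mem_iff_right (S.smul_mem _ (hr hi h'))).1 h)
    · exact hr hi h'
  rw [eq_top_iff, ← (Pi.basisFun R (Ref N)).span_eq, Submodule.span_le]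
  rintro _ ⟨s, rfl⟩
  rw [Pi.basisFun_apply, single_eq_vec]
  exact hall _ _ s.property.1 s.property.2.1 s.property.2.2

end Krammer

/-- Krammer's formulas define a representation of the braid group `B_{n+1}`: the `R`-linear
maps on the free module `V = ⊕_{1 ≤ i < j ≤ n+1} R x_{i,j}` determined by the explicit
formulas for `σ_k (x_{i,j})` are invertible and satisfy the braid relations, hence define a
group homomorphism `B_{n+1} → GL(V)`. Here the generator indexed by `k : Fin n` is
`σ_{k+1}`, and the basis vector at the index `s = (i,j)` is `Pi.single s 1`. -/
theorem krammer_representation {R : Type*} [CommRing R] (q t : R)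
    (hq : IsUnit q) (ht : IsUnit t) (n : ℕ) :
    ∃ ρ : BraidGroup n →* LinearMap.GeneralLinearGroup R (Ref (n + 1) → R),
      ∀ (k : Fin n) (s : Ref (n + 1)),
        ((ρ (PresentedGroup.of k) : (Ref (n + 1) → R) →ₗ[R] (Ref (n + 1) → R))
            (Pi.single s 1))
          = fun r : Ref (n + 1) => krammerCoeff q t ((k : ℕ) + 1) s.val.1 s.val.2 r.val := by
  have hu (k : Fin n) : IsUnit (Krammer.sigma (n + 1) q t ((k : ℕ) + 1)) :=
    Krammer.isUnit_sigma hq ht (by omega) (by omega)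
  have hrel : ∀ r ∈ braidRels n, FreeGroup.lift (fun k => (hu k).unit) r = 1 := by
    rintro r (⟨i, j, hij, rfl⟩ | ⟨i, j, hij, rfl⟩)
    · simp only [map_mul, map_inv, FreeGroup.lift_apply_of]
      rw [mul_inv_eq_one, mul_inv_eq_iff_eq_mul]
      apply Units.ext
      simpa using Krammer.sigma_comm q t (by omega) (by omega) (by omega)
    · simp only [map_mul, map_inv, FreeGroup.lift_apply_of]
      rw [mul_inv_eq_one]
      apply Units.ext
      simpa [hij] using Krammer.sigma_braid q t (by omega) (by omega)
  refine ⟨PresentedGroup.toGroup hrel, fun k s => ?_⟩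
  rw [PresentedGroup.toGroup.of]
  exact Krammer.sigma_single q t _ s
end

section
/- The leftmost-factor map defines a monoid action: for the map LF : B_n^+ → Ω (sending a positive braid x to r(x') where x' is the unique longest element of S_n with x ∈ r(x')B_n^+), the identity LF(xy) = LF(x · LF(y)) holds for all x, y ∈ B_n^+; consequently (x, y) ↦ LF(xy) defines an action of the monoid B_n^+ on the finite set Ω = r(S_n). -/
def adjTransposition (n : ℕ) (i : Fin n) : Equiv.Perm (Fin (n + 1)) :=
  Equiv.swap i.castSucc i.succ

noncomputable def wordLen (n : ℕ) (x : Equiv.Perm (Fin (n + 1))) : ℕ :=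
  sInf {k | ∃ w : List (Fin n), w.length = k ∧ (w.map (adjTransposition n)).prod = x}

/-- The positive braid monoid `B_{n+1}^+`, the submonoid generated by `σ_1, ..., σ_n`. -/
def posBraidMonoid (n : ℕ) : Submonoid (BraidGroup n) :=
  Submonoid.closure (Set.range fun i : Fin n => PresentedGroup.of (rels := braidRels n) i)

/-- Defining relations of the positive braid monoid on `n + 1` strands. -/
inductive PosBraidRel (n : ℕ) : FreeMonoid (Fin n) → FreeMonoid (Fin n) → Prop
  | far (i j : Fin n) (h : (i : ℕ) + 2 ≤ j) : PosBraidRel n (.of i * .of j) (.of j * .of i)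
  | braid (i j : Fin n) (h : (j : ℕ) = i + 1) :
      PosBraidRel n (.of i * .of j * .of i) (.of j * .of i * .of j)

/-- The positive braid monoid given abstractly by generators and relations. -/
abbrev AbsBraidMonoid (n : ℕ) : Type := PresentedMonoid (PosBraidRel n)

namespace AbsBraidMonoid

variable {n : ℕ}

/-- The standard generators. -/
def σ (i : Fin n) : AbsBraidMonoid n := PresentedMonoid.of _ i

/-- The indices `i` and `j` are neighbours. -/
def Adj (i j : Fin n) : Prop := (i : ℕ) + 1 = j ∨ (j : ℕ) + 1 = i

/-- The generators with indices `i` and `j` are distinct and commute. -/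
def Far (i j : Fin n) : Prop := (i : ℕ) + 2 ≤ j ∨ (j : ℕ) + 2 ≤ i

theorem Adj.symm {i j : Fin n} (h : Adj i j) : Adj j i := Or.symm h

theorem Far.symm {i j : Fin n} (h : Far i j) : Far j i := Or.symm h

theorem eq_or_far_or_adj (i j : Fin n) : i = j ∨ Far i j ∨ Adj i j := by
  simp only [Adj, Far, Fin.ext_iff]; omega

theorem σ_far {i j : Fin n} (h : Far i j) : σ i * σ j = σ j * σ i := by
  rcases h with h | h
  · exact PresentedMonoid.mk_eq_mk_of_rel (.far i j h)
  · exact (PresentedMonoid.mk_eq_mk_of_rel (.far j i h)).symm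

theorem σ_adj {i j : Fin n} (h : Adj i j) : σ i * (σ j * σ i) = σ j * (σ i * σ j) := by
  rw [← mul_assoc, ← mul_assoc]
  rcases h with h | h
  · exact PresentedMonoid.mk_eq_mk_of_rel (.braid i j h.symm)
  · exact (PresentedMonoid.mk_eq_mk_of_rel (.braid j i h.symm)).symm

theorem σ_far_mul {i j : Fin n} (h : Far i j) (x : AbsBraidMonoid n) :
    σ i * (σ j * x) = σ j * (σ i * x) := by
  rw [← mul_assoc, σ_far h, mul_assoc]

theorem σ_adj_mul {i j : Fin n} (h : Adj i j) (x : AbsBraidMonoid n) :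
    σ i * (σ j * (σ i * x)) = σ j * (σ i * (σ j * x)) := by
  simpa only [mul_assoc] using congrArg (· * x) (σ_adj h)

theorem mk_of_mul (i : Fin n) (a : FreeMonoid (Fin n)) :
    PresentedMonoid.mk (PosBraidRel n) (.of i * a) = σ i * PresentedMonoid.mk _ a := rfl

/-- The word length as a homomorphism. -/
def lenHom : AbsBraidMonoid n →* Multiplicative ℕ :=
  PresentedMonoid.lift (fun _ => .ofAdd 1) (by
    rintro _ _ (⟨i, j, h⟩ | ⟨i, j, h⟩) <;> simp)

/-- The length of a positive braid. -/
def len (x : AbsBraidMonoid n) : ℕ := (lenHom x).toAdd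

@[simp] theorem len_one : len (1 : AbsBraidMonoid n) = 0 := by simp [len]

@[simp] theorem len_mul (x y : AbsBraidMonoid n) : len (x * y) = len x + len y := by simp [len]

@[simp] theorem len_σ (i : Fin n) : len (σ i) = 1 := rfl

theorem len_mk (a : FreeMonoid (Fin n)) : len (PresentedMonoid.mk _ a) = a.length := by
  induction a using FreeMonoid.recOn with
  | one => simp
  | of_mul i a ih => rw [mk_of_mul, len_mul, len_σ, ih, FreeMonoid.length_mul, FreeMonoid.length_of]

theorem eq_one_or_σ_mul (x : AbsBraidMonoid n) : x = 1 ∨ ∃ i y, x = σ i * y := by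
  obtain ⟨a, rfl⟩ := PresentedMonoid.surjective_mk x
  cases a using FreeMonoid.casesOn with
  | one => simp
  | of_mul i a => exact .inr ⟨i, _, mk_of_mul i a⟩

@[elab_as_elim]
theorem σ_induction {p : AbsBraidMonoid n → Prop} (one : p 1)
    (mul : ∀ i x, p x → p (σ i * x)) (x : AbsBraidMonoid n) : p x := by
  obtain ⟨a, rfl⟩ := PresentedMonoid.surjective_mk x
  induction a using FreeMonoid.recOn with
  | one => simpa
  | of_mul i a ih => exact mul i _ ih

theorem eq_one_of_len_eq_zero {x : AbsBraidMonoid n} (h : len x = 0) : x = 1 := by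
  rcases eq_one_or_σ_mul x with rfl | ⟨i, y, rfl⟩
  · rfl
  · simp [len_mul] at h

open Classical in
/-- The complement `i \ j`: the element for which `σ i * (i \ j)` is the least common right
multiple of `σ i` and `σ j`. -/
noncomputable def compl (i j : Fin n) : AbsBraidMonoid n :=
  if i = j then 1 else if Adj i j then σ j * σ i else σ j

@[simp] theorem compl_self (i : Fin n) : compl i i = 1 := by simp [compl]

theorem compl_far {i j : Fin n} (h : Far i j) : compl i j = σ j := by
  have h1 : i ≠ j := by rintro rfl; simp [Far] at h
  have h2 : ¬ Adj i j := by simp only [Far, Adj] at *; omega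
  simp [compl, h1, h2]

theorem compl_adj {i j : Fin n} (h : Adj i j) : compl i j = σ j * σ i := by
  have h1 : i ≠ j := by rintro rfl; simp [Adj] at h
  simp [compl, h1, h]

theorem σ_mul_compl (i j : Fin n) : σ i * compl i j = σ j * compl j i := by
  rcases eq_or_far_or_adj i j with rfl | h | h
  · rfl
  · rw [compl_far h, compl_far h.symm, σ_far h]
  · rw [compl_adj h, compl_adj h.symm, σ_adj h]

/-- The elements of length less than `m` have the property of Garside's lemma. -/
def GarsideBelow (n m : ℕ) : Prop :=
  ∀ (i j : Fin n) (a b : AbsBraidMonoid n), len a < m → σ i * a = σ j * b →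
    ∃ c, a = compl i j * c ∧ b = compl j i * c

namespace GarsideBelow

variable {m : ℕ} {i j k : Fin n} {a b : AbsBraidMonoid n}

theorem self (G : GarsideBelow n m) (hl : len a < m) (h : σ i * a = σ i * b) : a = b := by
  obtain ⟨c, hc⟩ := G i i a b hl h
  simpa using hc.1.trans hc.2.symm

theorem far (G : GarsideBelow n m) (hij : Far i j) (hl : len a < m) (h : σ i * a = σ j * b) :
    ∃ c, a = σ j * c ∧ b = σ i * c := by
  simpa only [compl_far hij, compl_far hij.symm] using G i j a b hl h

theorem adj (G : GarsideBelow n m) (hij : Adj i j) (hl : len a < m) (h : σ i * a = σ j * b) :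
    ∃ c, a = σ j * (σ i * c) ∧ b = σ i * (σ j * c) := by
  simpa only [compl_adj hij, compl_adj hij.symm, mul_assoc] using G i j a b hl h

/-- The cube condition for three generators, one of which neighbours the other two. -/
theorem cube_aux_adj (G : GarsideBelow n m) (hki : Adj k i) (hij : Adj i j) (hkj : Far k j)
    {c₁ c₂ : AbsBraidMonoid n} (hl : len (compl k i * c₁) ≤ m)
    (h : compl k i * c₁ = compl k j * c₂) :
    ∃ c, compl i k * c₁ = compl i j * c ∧ compl j k * c₂ = compl j i * c := by
  simp only [compl_adj hki, compl_adj hki.symm, compl_adj hij, compl_adj hij.symm,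
    compl_far hkj, compl_far hkj.symm, mul_assoc, len_mul, len_σ] at *
  obtain ⟨d, h1, h2⟩ := G.adj hij (by simp; omega) h
  have hd := congrArg len h1
  simp only [len_mul, len_σ] at hd
  obtain ⟨e, h3, h4⟩ := G.far hkj (by omega) h1
  have he := congrArg len h4
  simp only [len_mul, len_σ] at he
  obtain ⟨f, h5, h6⟩ := G.adj hki.symm (by omega) h4
  subst h5 h6 h3 h2
  refine ⟨σ k * (σ i * (σ j * f)), ?_, ?_⟩
  · rw [σ_adj_mul hij, σ_far_mul hkj, σ_far_mul hkj.symm f, σ_adj_mul hki]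
  · rw [σ_far_mul hkj.symm, σ_adj_mul hki, σ_adj_mul hij, σ_far_mul hkj]

/-- The cube condition for three generators, one of which commutes with the other two. -/
theorem cube_aux_far (G : GarsideBelow n m) (hki : Far k i) (hij : Far i j) (hkj : Adj k j)
    {c₁ c₂ : AbsBraidMonoid n} (hl : len (compl k i * c₁) ≤ m)
    (h : compl k i * c₁ = compl k j * c₂) :
    ∃ c, compl i k * c₁ = compl i j * c ∧ compl j k * c₂ = compl j i * c := by
  simp only [compl_far hki, compl_far hki.symm, compl_far hij, compl_far hij.symm,
    compl_adj hkj, compl_adj hkj.symm, mul_assoc, len_mul, len_σ] at *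
  obtain ⟨e, rfl, h2⟩ := G.far hij (by omega) h
  have he := congrArg len h2
  simp only [len_mul, len_σ] at he hl
  obtain ⟨f, rfl, rfl⟩ := G.far hki (by omega) h2
  refine ⟨σ k * (σ j * f), σ_adj_mul hkj f, ?_⟩
  rw [σ_far_mul hij.symm, σ_far_mul hki]

theorem cube (G : GarsideBelow n m) (i k j : Fin n) {c₁ c₂ : AbsBraidMonoid n}
    (hl : len (compl k i * c₁) ≤ m) (h : compl k i * c₁ = compl k j * c₂) :
    ∃ c, compl i k * c₁ = compl i j * c ∧ compl j k * c₂ = compl j i * c := by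
  have hl' := h ▸ hl
  rcases eq_or_far_or_adj k i with rfl | hki | hki
  · exact ⟨c₂, by simpa using h, rfl⟩
  · rcases eq_or_far_or_adj k j with rfl | hkj | hkj
    · exact ⟨c₁, rfl, by simpa using h.symm⟩
    · rcases eq_or_far_or_adj i j with rfl | hij | hij
      · simp only [compl_far hki, len_mul, len_σ] at *
        exact ⟨σ k * c₁, by simp [compl_far hki.symm], by
          simp [compl_far hki.symm, G.self (by omega) h]⟩
      · simp only [compl_far hki, compl_far hki.symm, compl_far hij, compl_far hij.symm,
          compl_far hkj, compl_far hkj.symm, len_mul, len_σ] at *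
        obtain ⟨c, rfl, rfl⟩ := G.far hij (by omega) h
        exact ⟨σ k * c, σ_far_mul hkj c, σ_far_mul hki c⟩
      · simp only [compl_far hki, compl_far hki.symm, compl_adj hij, compl_adj hij.symm,
          compl_far hkj, compl_far hkj.symm, len_mul, len_σ, mul_assoc] at *
        obtain ⟨c, rfl, rfl⟩ := G.adj hij (by omega) h
        refine ⟨σ k * c, ?_, ?_⟩
        · rw [σ_far_mul hkj, σ_far_mul hki]
        · rw [σ_far_mul hki, σ_far_mul hkj]
    · rcases eq_or_far_or_adj i j with rfl | hij | hij
      · simp only [Far, Adj] at *; omega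
      · exact cube_aux_far G hki hij hkj hl h
      · obtain ⟨c, h1, h2⟩ := cube_aux_adj G hkj hij.symm hki hl' h.symm
        exact ⟨c, h2, h1⟩
  · rcases eq_or_far_or_adj k j with rfl | hkj | hkj
    · exact ⟨c₁, rfl, by simpa using h.symm⟩
    · rcases eq_or_far_or_adj i j with rfl | hij | hij
      · simp only [Far, Adj] at *; omega
      · obtain ⟨c, h1, h2⟩ := cube_aux_far G hkj hij.symm hki hl' h.symm
        exact ⟨c, h2, h1⟩
      · exact cube_aux_adj G hki hij hkj hl h
    · rcases eq_or_far_or_adj i j with rfl | hij | hij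
      · simp only [compl_adj hki, compl_adj hki.symm, compl_self, mul_assoc, len_mul, len_σ] at *
        have := G.self (by simp; omega) h
        exact ⟨σ k * (σ i * c₁), by simp, by simp [G.self (by omega) this]⟩
      · simp only [compl_adj hki, compl_adj hki.symm, compl_far hij, compl_far hij.symm,
          compl_adj hkj, compl_adj hkj.symm, len_mul, len_σ, mul_assoc] at *
        obtain ⟨e, h1, h2⟩ := G.far hij (by simp; omega) h
        have he := congrArg len h1
        simp only [len_mul, len_σ] at he
        obtain ⟨f, h3, h4⟩ := G.adj hkj (by omega) h1
        obtain ⟨g, h5, h6⟩ := G.adj hki (by omega) h2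
        have hf := congrArg len h3
        simp only [len_mul, len_σ] at hf
        have h7 := h4.symm.trans h6
        have h8 := G.far hij.symm (by omega) (G.self (by simp; omega) h7)
        obtain ⟨p, rfl, rfl⟩ := h8
        subst h3 h5
        refine ⟨σ k * (σ j * (σ i * (σ k * p))), ?_, ?_⟩
        · rw [σ_far_mul hij, σ_adj_mul hki.symm, σ_adj_mul hkj]
        · rw [σ_far_mul hij.symm, σ_adj_mul hkj.symm, σ_adj_mul hki, σ_far_mul hij]
      · simp only [Adj] at *; omega

/-- Two words are related when they have the same value, the same length, and (if they are not too
long) their values satisfy the conclusion of Garside's lemma with respect to the first letters. -/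
def WordRel (n m : ℕ) (u v : FreeMonoid (Fin n)) : Prop :=
  PresentedMonoid.mk (PosBraidRel n) u = PresentedMonoid.mk _ v ∧ (u.length ≤ m + 1 →
    ∀ i j a b, u = .of i * a → v = .of j * b → ∃ c,
      PresentedMonoid.mk _ a = compl i j * c ∧ PresentedMonoid.mk _ b = compl j i * c)

theorem WordRel.length_eq {u v : FreeMonoid (Fin n)} (h : WordRel n m u v) :
    u.length = v.length := by
  rw [← len_mk, ← len_mk, h.1]

theorem of_mul_inj {i j : Fin n} {a b : FreeMonoid (Fin n)}
    (h : FreeMonoid.of i * a = .of j * b) : i = j ∧ a = b :=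
  List.cons_eq_cons.mp (congrArg FreeMonoid.toList h)

theorem wordRel_of_conGen (G : GarsideBelow n m) {u v : FreeMonoid (Fin n)}
    (h : ConGen.Rel (PosBraidRel n) u v) : WordRel n m u v := by
  induction h with
  | of x y h =>
    refine ⟨PresentedMonoid.mk_eq_mk_of_rel h, fun _ i j a b hx hy => ⟨1, ?_⟩⟩
    rcases h with ⟨p, q, h⟩ | ⟨p, q, h⟩
    · obtain ⟨rfl, rfl⟩ := of_mul_inj hx
      obtain ⟨rfl, rfl⟩ := of_mul_inj hy
      rw [compl_far (.inl h), compl_far (.inr h)]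
      exact ⟨rfl, rfl⟩
    · rw [mul_assoc] at hx hy
      obtain ⟨rfl, rfl⟩ := of_mul_inj hx
      obtain ⟨rfl, rfl⟩ := of_mul_inj hy
      rw [compl_adj (.inl h.symm), compl_adj (.inr h.symm)]
      exact ⟨rfl, rfl⟩
  | refl x =>
    refine ⟨rfl, fun _ i j a b hx hy => ?_⟩
    obtain ⟨rfl, rfl⟩ := of_mul_inj (hx.symm.trans hy)
    exact ⟨_, by rw [compl_self, one_mul], by rw [compl_self, one_mul]⟩
  | symm _ ih =>
    refine ⟨ih.1.symm, fun hl i j a b hx hy => ?_⟩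
    obtain ⟨c, h1, h2⟩ := ih.2 (by rwa [ih.length_eq]) j i b a hy hx
    exact ⟨c, h2, h1⟩
  | @trans x y z _ _ ih₁ ih₂ =>
    refine ⟨ih₁.1.trans ih₂.1, fun hl i j a b hx hz => ?_⟩
    have h1 := ih₁.length_eq
    cases y using FreeMonoid.casesOn with
    | one => simp [hx] at h1
    | of_mul k d =>
      obtain ⟨c₁, ha, hd⟩ := ih₁.2 hl i k a d hx rfl
      obtain ⟨c₂, hd', hb⟩ := ih₂.2 (h1 ▸ hl) k j d b rfl hz
      rw [ha, hb]
      refine G.cube i k j ?_ (hd.symm.trans hd')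
      rw [← hd, len_mk]
      simp only [FreeMonoid.length_mul, FreeMonoid.length_of] at h1
      omega
  | @mul w x y z _ _ ih₁ ih₂ =>
    refine ⟨by rw [map_mul, map_mul, ih₁.1, ih₂.1], fun hl i j a b hx hz => ?_⟩
    have h1 := ih₁.length_eq
    have h2 := ih₂.length_eq
    cases w using FreeMonoid.casesOn with
    | one =>
      obtain rfl : x = 1 := FreeMonoid.length_eq_zero.mp (by simpa using h1.symm)
      rw [one_mul] at hl hx hz
      exact ih₂.2 hl i j a b hx hz
    | of_mul k w =>
      cases x using FreeMonoid.casesOn with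
      | one => simp at h1
      | of_mul k' x =>
        rw [mul_assoc] at hx hz
        obtain ⟨rfl, rfl⟩ := of_mul_inj hx
        obtain ⟨rfl, rfl⟩ := of_mul_inj hz
        rw [FreeMonoid.length_mul] at hl
        obtain ⟨c, hc, hc'⟩ := ih₁.2 (by omega) k k' w x rfl rfl
        exact ⟨c * PresentedMonoid.mk _ y, by rw [map_mul, hc, mul_assoc],
          by rw [map_mul, hc', ih₂.1, mul_assoc]⟩

end GarsideBelow

theorem garsideBelow (n m : ℕ) : GarsideBelow n m := by
  induction m with
  | zero => exact fun i j a b h => absurd h (by simp)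
  | succ m ih =>
    intro i j a b hl h
    obtain ⟨a, rfl⟩ := PresentedMonoid.surjective_mk a
    obtain ⟨b, rfl⟩ := PresentedMonoid.surjective_mk b
    rw [← mk_of_mul, ← mk_of_mul, PresentedMonoid.mk_eq_mk_iff] at h
    refine (GarsideBelow.wordRel_of_conGen ih h).2 ?_ i j a b rfl rfl
    rw [len_mk] at hl
    simp only [FreeMonoid.length_mul, FreeMonoid.length_of]
    omega

/-- **Garside's lemma**. -/
theorem exists_eq_compl_mul {i j : Fin n} {a b : AbsBraidMonoid n} (h : σ i * a = σ j * b) :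
    ∃ c, a = compl i j * c ∧ b = compl j i * c :=
  garsideBelow n _ i j a b (Nat.lt_succ_self _) h

instance : IsLeftCancelMul (AbsBraidMonoid n) where
  mul_left_cancel x a b h := by
    induction x using σ_induction with
    | one => simpa using h
    | mul i x ih =>
      simp only [mul_assoc] at h
      exact ih ((garsideBelow n _).self (Nat.lt_succ_self _) h)

/-- Reversal of words, as a homomorphism to the opposite monoid. -/
def revHom : AbsBraidMonoid n →* (AbsBraidMonoid n)ᵐᵒᵖ :=
  PresentedMonoid.lift (fun i => .op (σ i)) (by
    rintro _ _ (⟨i, j, h⟩ | ⟨i, j, h⟩)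
    · simp [← MulOpposite.op_mul, σ_far (i := j) (.inr h)]
    · simp [← MulOpposite.op_mul, σ_adj (i := i) (.inl h.symm)])

/-- Reversal of words. -/
def rev (x : AbsBraidMonoid n) : AbsBraidMonoid n := (revHom x).unop

theorem rev_mul (x y : AbsBraidMonoid n) : rev (x * y) = rev y * rev x := by simp [rev]

theorem rev_rev (x : AbsBraidMonoid n) : rev (rev x) = x := by
  induction x using σ_induction with
  | one => simp [rev]
  | mul i x ih => rw [rev_mul, rev_mul, ih]; rfl

instance : IsRightCancelMul (AbsBraidMonoid n) where
  mul_right_cancel x a b h := by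
    replace h := congrArg rev h
    simp only [rev_mul] at h
    rw [← rev_rev a, mul_left_cancel h, rev_rev]

theorem dvd_of_left_mul_dvd_left_mul {a b c : AbsBraidMonoid n} (h : a * b ∣ a * c) : b ∣ c := by
  obtain ⟨d, hd⟩ := h
  exact ⟨d, mul_left_cancel (hd.trans (mul_assoc a b d))⟩

/-- Elements with a common right multiple have a least common right multiple. -/
theorem exists_lcm {a b z : AbsBraidMonoid n} (ha : a ∣ z) (hb : b ∣ z) :
    ∃ t, a ∣ t ∧ b ∣ t ∧ ∀ z', a ∣ z' → b ∣ z' → t ∣ z' := by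
  induction hm : len z using Nat.strong_induction_on generalizing a b z with
  | _ m ih =>
    subst hm
    rcases eq_one_or_σ_mul a with rfl | ⟨i, a, rfl⟩
    · exact ⟨b, one_dvd _, dvd_rfl, fun _ _ h => h⟩
    rcases eq_one_or_σ_mul b with rfl | ⟨j, b, rfl⟩
    · exact ⟨_, dvd_rfl, one_dvd _, fun _ h _ => h⟩
    have key : ∀ z', σ i * a ∣ z' → σ j * b ∣ z' → ∃ c, z' = σ i * (compl i j * c) ∧
        a ∣ compl i j * c ∧ b ∣ compl j i * c := by
      rintro _ ⟨x, rfl⟩ ⟨y, hy⟩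
      simp only [mul_assoc] at hy
      obtain ⟨c, h1, h2⟩ := exists_eq_compl_mul hy
      exact ⟨c, by rw [mul_assoc, h1], h1 ▸ dvd_mul_right _ _, h2 ▸ dvd_mul_right _ _⟩
    have hcompl (c) : σ i * (compl i j * c) = σ j * (compl j i * c) := by
      rw [← mul_assoc, σ_mul_compl, mul_assoc]
    obtain ⟨c, rfl, hac, hbc⟩ := key z ha hb
    have hl := congrArg len (hcompl c)
    simp only [len_mul, len_σ] at hl
    obtain ⟨t₁, h1, ⟨p, rfl⟩, h1'⟩ := ih _ (by simp) hac (dvd_mul_right (compl i j) c) rfl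
    obtain ⟨t₂, h2, ⟨q, rfl⟩, h2'⟩ :=
      ih _ (by simp; omega) hbc (dvd_mul_right (compl j i) c) rfl
    have hpc : ∀ c, a ∣ compl i j * c → p ∣ c := fun c hc =>
      dvd_of_left_mul_dvd_left_mul (h1' _ hc (dvd_mul_right _ _))
    have hqc : ∀ c, b ∣ compl j i * c → q ∣ c := fun c hc =>
      dvd_of_left_mul_dvd_left_mul (h2' _ hc (dvd_mul_right _ _))
    obtain ⟨t, ⟨p', rfl⟩, ⟨q', hq⟩, ht'⟩ := ih (len c) (by simp; omega) (hpc c hac) (hqc c hbc) rfl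
    refine ⟨σ i * (compl i j * (p * p')), ?_, ?_, fun z' hz1 hz2 => ?_⟩
    · rw [← mul_assoc (compl i j)]
      exact mul_dvd_mul_left _ (h1.mul_right _)
    · rw [hcompl, hq, ← mul_assoc (compl j i)]
      exact mul_dvd_mul_left _ (h2.mul_right _)
    · obtain ⟨c', rfl, hc1, hc2⟩ := key z' hz1 hz2
      exact mul_dvd_mul_left _ (mul_dvd_mul_left _ (ht' c' (hpc c' hc1) (hqc c' hc2)))

end AbsBraidMonoid

namespace Equiv.Perm

variable {n : ℕ}

/-- The set of inversions of a permutation. -/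
def invSet (w : Perm (Fin (n + 1))) : Finset (Fin (n + 1) × Fin (n + 1)) :=
  {p | p.1 < p.2 ∧ w p.2 < w p.1}

/-- The number of inversions of a permutation. -/
def inv (w : Perm (Fin (n + 1))) : ℕ := w.invSet.card

theorem mem_invSet {w : Perm (Fin (n + 1))} {p : Fin (n + 1) × Fin (n + 1)} :
    p ∈ w.invSet ↔ p.1 < p.2 ∧ w p.2 < w p.1 := by simp [invSet]

@[simp] theorem inv_one : inv (1 : Perm (Fin (n + 1))) = 0 := by
  simp only [inv, Finset.card_eq_zero, Finset.eq_empty_iff_forall_notMem, mem_invSet, one_apply]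
  exact fun p h => h.1.asymm h.2

@[simp] theorem inv_inv (w : Perm (Fin (n + 1))) : inv w⁻¹ = inv w := by
  refine Finset.card_bij (fun p _ => (w⁻¹ p.2, w⁻¹ p.1)) ?_ ?_ ?_
  · intro p hp
    rw [mem_invSet] at *
    simpa using hp.symm
  · rintro ⟨a, b⟩ _ ⟨c, d⟩ _ h
    simp_all
  · rintro ⟨a, b⟩ hp
    rw [mem_invSet] at hp
    exact ⟨(w b, w a), by rw [mem_invSet]; simpa using hp.symm, by simp⟩

theorem adj_adj (i : Fin n) : adjTransposition n i * adjTransposition n i = 1 :=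
  Equiv.swap_mul_self _ _

@[simp] theorem adj_castSucc (i : Fin n) : adjTransposition n i i.castSucc = i.succ :=
  Equiv.swap_apply_left _ _

@[simp] theorem adj_succ (i : Fin n) : adjTransposition n i i.succ = i.castSucc :=
  Equiv.swap_apply_right _ _

theorem adj_apply_of_ne {i : Fin n} {a : Fin (n + 1)} (h1 : (a : ℕ) ≠ i) (h2 : (a : ℕ) ≠ i + 1) :
    adjTransposition n i a = a :=
  Equiv.swap_apply_of_ne_of_ne (by simpa [Fin.ext_iff]) (by simpa [Fin.ext_iff])

@[simp] theorem adj_apply_adj (i : Fin n) (a : Fin (n + 1)) :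
    adjTransposition n i (adjTransposition n i a) = a := by
  rw [← mul_apply, adj_adj, one_apply]

theorem coe_adj (i : Fin n) (a : Fin (n + 1)) : (adjTransposition n i a : ℕ) =
    if (a : ℕ) = i then (i : ℕ) + 1 else if (a : ℕ) = i + 1 then (i : ℕ) else a := by
  simp only [adjTransposition, Equiv.swap_apply_def, Fin.ext_iff, Fin.val_castSucc, Fin.val_succ]
  split_ifs <;> simp

theorem adj_lt_adj {i : Fin n} {a b : Fin (n + 1)} (h : a < b)
    (hab : (a, b) ≠ (i.castSucc, i.succ)) : adjTransposition n i a < adjTransposition n i b := by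
  simp only [Ne, Prod.mk.injEq, Fin.ext_iff, Fin.val_castSucc, Fin.val_succ, Fin.lt_def,
    coe_adj] at *
  split_ifs <;> omega

theorem inv_mul_adj {w : Perm (Fin (n + 1))} {i : Fin n} (h : w i.castSucc < w i.succ) :
    inv (w * adjTransposition n i) = inv w + 1 := by
  have hlt : i.castSucc < i.succ := Fin.castSucc_lt_succ
  have hs : invSet (w * adjTransposition n i) = insert (i.castSucc, i.succ)
      (w.invSet.map ((adjTransposition n i).prodCongr (adjTransposition n i)).toEmbedding) := by
    ext ⟨a, b⟩
    simp only [Finset.mem_insert, Finset.mem_map_equiv, mem_invSet, Equiv.prodCongr_symm,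
      Equiv.prodCongr_apply, Prod.map, mul_apply]
    have hsymm : (adjTransposition n i).symm = adjTransposition n i := Equiv.symm_swap _ _
    rw [hsymm]
    by_cases hab : (a, b) = (i.castSucc, i.succ)
    · simp only [Prod.mk.injEq] at hab
      obtain ⟨rfl, rfl⟩ := hab
      simp [h]
    · simp only [hab, false_or]
      refine and_congr_left fun hw => ⟨fun h' => adj_lt_adj h' hab, fun h' => ?_⟩
      have := adj_lt_adj (i := i) h' (by
        rintro h''
        rw [Prod.mk.injEq] at h''
        rw [h''.1, h''.2] at hw
        exact hw.asymm h)
      simpa using this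
  rw [inv, hs, Finset.card_insert_of_notMem, Finset.card_map, inv]
  simp only [Finset.mem_map_equiv, mem_invSet, Equiv.prodCongr_symm, Equiv.prodCongr_apply,
    Prod.map]
  rintro ⟨h', -⟩
  have hsymm : (adjTransposition n i).symm = adjTransposition n i := Equiv.symm_swap _ _
  rw [hsymm, adj_castSucc, adj_succ] at h'
  exact h'.asymm hlt

theorem inv_mul_adj_add_one {w : Perm (Fin (n + 1))} {i : Fin n} (h : w i.succ < w i.castSucc) :
    inv (w * adjTransposition n i) + 1 = inv w := by
  rw [← inv_mul_adj (i := i) (by simpa using h), mul_assoc, adj_adj, mul_one]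

theorem lt_or_gt_adj (w : Perm (Fin (n + 1))) (i : Fin n) :
    w i.castSucc < w i.succ ∨ w i.succ < w i.castSucc :=
  lt_or_gt_of_ne fun h => Fin.castSucc_lt_succ.ne (w.injective h)

theorem lt_of_inv_mul_adj {w : Perm (Fin (n + 1))} {i : Fin n}
    (h : inv w < inv (w * adjTransposition n i)) : w i.castSucc < w i.succ := by
  refine (lt_or_gt_adj w i).resolve_right fun h' => ?_
  have := inv_mul_adj_add_one h'
  omega

theorem inv_mul_adj_le (w : Perm (Fin (n + 1))) (i : Fin n) :
    inv (w * adjTransposition n i) ≤ inv w + 1 := by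
  rcases lt_or_gt_adj w i with h | h
  · exact (inv_mul_adj h).le
  · have := inv_mul_adj_add_one h
    omega

theorem exists_descent {w : Perm (Fin (n + 1))} (hw : w ≠ 1) :
    ∃ i : Fin n, w i.succ < w i.castSucc := by
  by_contra! h
  have hm : StrictMono w := Fin.strictMono_iff_lt_succ.mpr fun i =>
    (lt_or_gt_adj w i).resolve_right (h i).not_gt
  refine hw (Equiv.ext fun a => ?_)
  exact DFunLike.congr_fun (Subsingleton.elim
    (hm.orderIsoOfSurjective _ w.surjective) (OrderIso.refl _)) a

/-- Every permutation is reached from the identity by adding one inversion at a time. -/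
@[elab_as_elim]
theorem ascent_induction {p : Perm (Fin (n + 1)) → Prop} (one : p 1)
    (mul : ∀ w (i : Fin n), w i.castSucc < w i.succ → p w → p (w * adjTransposition n i))
    (w : Perm (Fin (n + 1))) : p w := by
  induction h : inv w using Nat.strong_induction_on generalizing w with
  | _ m ih =>
    by_cases hw : w = 1
    · rwa [hw]
    obtain ⟨i, hi⟩ := exists_descent hw
    have := mul (w * adjTransposition n i) i (by simpa using hi)
      (ih _ (by rw [← inv_mul_adj_add_one hi] at h; omega) _ rfl)
    rwa [mul_assoc, adj_adj, mul_one] at this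

theorem inv_prod_le (l : List (Fin n)) : inv (l.map (adjTransposition n)).prod ≤ l.length := by
  induction l using List.reverseRecOn with
  | nil => simp
  | append_singleton l i ih =>
    have := inv_mul_adj_le (l.map (adjTransposition n)).prod i
    simp only [List.map_append, List.prod_append, List.map_singleton, List.prod_singleton,
      List.length_append, List.length_singleton]
    omega

theorem exists_word (w : Perm (Fin (n + 1))) :
    ∃ l : List (Fin n), l.length = inv w ∧ (l.map (adjTransposition n)).prod = w := by
  induction w using ascent_induction with
  | one => exact ⟨[], by simp⟩
  | mul w i h ih =>
    obtain ⟨l, hl, hw⟩ := ih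
    exact ⟨l ++ [i], by simp [hl, inv_mul_adj h], by simp [hw]⟩

theorem wordLen_eq_inv (w : Perm (Fin (n + 1))) : wordLen n w = inv w := by
  refine le_antisymm (Nat.sInf_le (exists_word w)) (le_csInf ⟨_, exists_word w⟩ ?_)
  rintro _ ⟨l, rfl, rfl⟩
  exact inv_prod_le l

theorem inv_mul_le (u v : Perm (Fin (n + 1))) : inv (u * v) ≤ inv u + inv v := by
  induction v using ascent_induction with
  | one => simp
  | mul v i h ih =>
    have := inv_mul_adj_le (u * v) i
    rw [inv_mul_adj h, ← mul_assoc]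
    omega

theorem inv_rev_mul_add (w : Perm (Fin (n + 1))) :
    inv (Fin.revPerm * w) + inv w = inv (Fin.revPerm : Perm (Fin (n + 1))) := by
  have h1 : invSet (Fin.revPerm : Perm (Fin (n + 1))) = invSet (Fin.revPerm * w) ∪ invSet w := by
    ext p
    simp only [Finset.mem_union, mem_invSet, mul_apply, Fin.revPerm_apply, Fin.rev_lt_rev,
      and_self, ← and_or_left]
    exact ⟨fun h => ⟨h, lt_or_gt_of_ne fun h' => h.ne (w.injective h')⟩, fun h => h.1⟩
  have h2 : _root_.Disjoint (invSet (Fin.revPerm * w)) (invSet w) := by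
    refine Finset.disjoint_left.mpr fun p hp hq => ?_
    simp only [mem_invSet, mul_apply, Fin.revPerm_apply, Fin.rev_lt_rev] at hp hq
    exact hp.2.asymm hq.2
  rw [inv, inv, ← Finset.card_union_of_disjoint h2, ← h1, inv]

theorem inv_add_inv_mul_rev (w : Perm (Fin (n + 1))) :
    inv w + inv (w⁻¹ * Fin.revPerm) = inv (Fin.revPerm : Perm (Fin (n + 1))) := by
  have h : w⁻¹ * Fin.revPerm = (Fin.revPerm * w)⁻¹ := by
    rw [mul_inv_rev]; congr 1
  rw [h, inv_inv, add_comm, inv_rev_mul_add]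

theorem adj_rev_mul_rev (i : Fin n) :
    adjTransposition n i.rev * Fin.revPerm = Fin.revPerm * adjTransposition n i := by
  ext a
  simp only [mul_apply, Fin.revPerm_apply, coe_adj, Fin.val_rev]
  split_ifs <;> omega

end Equiv.Perm

namespace AbsBraidMonoid

open Equiv Equiv.Perm

variable {n : ℕ}

theorem adj_mul_adj_of_far {i j : Fin n} (h : Far i j) :
    adjTransposition n i * adjTransposition n j = adjTransposition n j * adjTransposition n i := by
  ext a
  simp only [Perm.mul_apply, coe_adj, Far] at *
  split_ifs <;> omega

theorem adj_mul_adj_of_adj {i j : Fin n} (h : Adj i j) :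
    adjTransposition n i * adjTransposition n j * adjTransposition n i =
      adjTransposition n j * adjTransposition n i * adjTransposition n j := by
  have key : ∀ i j : Fin n, (i : ℕ) + 1 = j → adjTransposition n i * adjTransposition n j *
      adjTransposition n i = adjTransposition n j * adjTransposition n i *
      adjTransposition n j := by
    intro i j h
    have e : j.castSucc = i.succ := Fin.ext h.symm
    have h1 : i.castSucc ≠ i.succ := Fin.castSucc_lt_succ.ne
    have h2 : i.succ ≠ j.succ := by simp only [Ne, Fin.ext_iff, Fin.val_succ]; omega
    have h3 : i.castSucc ≠ j.succ := by
      simp only [Ne, Fin.ext_iff, Fin.val_succ, Fin.val_castSucc]; omega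
    simp only [adjTransposition, e]
    rw [swap_mul_swap_mul_swap h1 h3, swap_comm i.castSucc, swap_comm i.succ j.succ,
      swap_mul_swap_mul_swap h2.symm h3.symm, swap_comm]
  rcases h with h | h
  · exact key i j h
  · exact (key j i h).symm

/-- `IsLift w x` means that `x` is the value of a reduced word for `w`. -/
inductive IsLift : Perm (Fin (n + 1)) → AbsBraidMonoid n → Prop
  | one : IsLift 1 1
  | mul_σ {w x} (i : Fin n) : IsLift w x → w i.castSucc < w i.succ →
      IsLift (w * adjTransposition n i) (x * σ i)

namespace IsLift

variable {w : Perm (Fin (n + 1))} {i j : Fin n} {c : AbsBraidMonoid n}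

theorem mul_of_descent (hw : w i.succ < w i.castSucc)
    (h : IsLift (w * adjTransposition n i) c) : IsLift w (c * σ i) := by
  have := h.mul_σ i (by simpa using hw)
  rwa [mul_assoc, adj_adj, mul_one] at this

theorem mul_of_far (hij : Far i j) (hj : w j.succ < w j.castSucc)
    (h : IsLift (w * adjTransposition n i * adjTransposition n j) c) :
    IsLift (w * adjTransposition n i) (c * σ j) := by
  refine mul_of_descent ?_ h
  simp only [Far] at hij
  rwa [Perm.mul_apply, Perm.mul_apply, adj_apply_of_ne, adj_apply_of_ne] <;>
    simp only [Fin.val_castSucc, Fin.val_succ] <;> omega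

theorem mul_of_adj (hij : Adj i j) (hi : w i.succ < w i.castSucc) (hj : w j.succ < w j.castSucc)
    (h : IsLift (w * (adjTransposition n i * adjTransposition n j * adjTransposition n i)) c) :
    IsLift (w * adjTransposition n i) (c * σ i * σ j) := by
  rw [← mul_assoc, ← mul_assoc] at h
  rcases hij with hij | hij
  · have e : j.castSucc = i.succ := Fin.ext hij.symm
    have e1 : adjTransposition n i j.succ = j.succ := by
      apply adj_apply_of_ne <;> simp only [Fin.val_succ] <;> omega
    have e2 : adjTransposition n j i.castSucc = i.castSucc := by
      apply adj_apply_of_ne <;> simp only [Fin.val_castSucc] <;> omega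
    have e3 : adjTransposition n j i.succ = j.succ := by rw [← e, adj_castSucc]
    rw [e] at hj
    refine mul_of_descent ?_ (mul_of_descent ?_ h)
    · simpa [e, e1] using hj.trans hi
    · simpa [e1, e2, e3] using hj
  · have e : j.succ = i.castSucc := Fin.ext hij
    have e1 : adjTransposition n i j.castSucc = j.castSucc := by
      apply adj_apply_of_ne <;> simp only [Fin.val_castSucc] <;> omega
    have e2 : adjTransposition n j i.succ = i.succ := by
      apply adj_apply_of_ne <;> simp only [Fin.val_succ] <;> omega
    have e3 : adjTransposition n j i.castSucc = j.castSucc := by rw [← e, adj_succ]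
    rw [e] at hj
    refine mul_of_descent ?_ (mul_of_descent ?_ h)
    · simpa [e, e1] using hi.trans hj
    · simpa [e1, e2, e3] using hj

theorem exists_isLift (w : Perm (Fin (n + 1))) : ∃ x, IsLift w x := by
  induction w using ascent_induction with
  | one => exact ⟨1, one⟩
  | mul w i h ih => exact ih.imp' (· * σ i) fun x hx => hx.mul_σ i h

theorem eq_one_or (h : IsLift w c) : w = 1 ∧ c = 1 ∨ ∃ i a, w i.succ < w i.castSucc ∧
    IsLift (w * adjTransposition n i) a ∧ c = a * σ i := by
  cases h with
  | one => exact .inl ⟨rfl, rfl⟩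
  | mul_σ i h hi => exact .inr ⟨i, _, by simpa using hi, by rwa [mul_assoc, adj_adj, mul_one], rfl⟩

/-- **Matsumoto's theorem** for the symmetric group. -/
theorem unique {x y : AbsBraidMonoid n} (hx : IsLift w x) (hy : IsLift w y) : x = y := by
  induction hm : inv w using Nat.strong_induction_on generalizing w x y with
  | _ m ih =>
    subst hm
    rcases hx.eq_one_or with ⟨rfl, rfl⟩ | ⟨i, a, hi, ha, rfl⟩
    · rcases hy.eq_one_or with ⟨-, rfl⟩ | ⟨j, b, hj, -⟩
      · rfl
      · exact absurd hj (by simp [Fin.lt_def])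
    rcases hy.eq_one_or with ⟨rfl, rfl⟩ | ⟨j, b, hj, hb, rfl⟩
    · exact absurd hi (by simp [Fin.lt_def])
    have hi' := inv_mul_adj_add_one hi
    have hj' := inv_mul_adj_add_one hj
    rcases eq_or_far_or_adj i j with rfl | hij | hij
    · rw [ih _ (by omega) ha hb rfl]
    · obtain ⟨c, hc⟩ := exists_isLift (w * adjTransposition n i * adjTransposition n j)
      rw [ih _ (by omega) ha (mul_of_far hij hj hc) rfl]
      rw [mul_assoc, adj_mul_adj_of_far hij, ← mul_assoc] at hc
      rw [ih _ (by omega) hb (mul_of_far hij.symm hi hc) rfl, mul_assoc, mul_assoc, σ_far hij]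
    · obtain ⟨c, hc⟩ := exists_isLift
        (w * (adjTransposition n i * adjTransposition n j * adjTransposition n i))
      rw [ih _ (by omega) ha (mul_of_adj hij hi hj hc) rfl]
      rw [adj_mul_adj_of_adj hij] at hc
      rw [ih _ (by omega) hb (mul_of_adj hij.symm hj hi hc) rfl]
      simp only [mul_assoc, σ_adj hij]

end IsLift

/-- The canonical section of the projection to the symmetric group. -/
noncomputable def lift (w : Perm (Fin (n + 1))) : AbsBraidMonoid n :=
  (IsLift.exists_isLift w).choose

theorem isLift_lift (w : Perm (Fin (n + 1))) : IsLift w (lift w) :=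
  (IsLift.exists_isLift w).choose_spec

theorem IsLift.eq_lift {w : Perm (Fin (n + 1))} {x : AbsBraidMonoid n} (h : IsLift w x) :
    x = lift w :=
  h.unique (isLift_lift w)

@[simp] theorem lift_one : lift (1 : Perm (Fin (n + 1))) = 1 := IsLift.one.eq_lift.symm

theorem lift_mul_adj {w : Perm (Fin (n + 1))} {i : Fin n} (h : w i.castSucc < w i.succ) :
    lift (w * adjTransposition n i) = lift w * σ i :=
  ((isLift_lift w).mul_σ i h).eq_lift.symm

theorem one_lt_one_adj (i : Fin n) :
    (1 : Perm (Fin (n + 1))) i.castSucc < (1 : Perm (Fin (n + 1))) i.succ := by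
  simp [Fin.lt_def]

@[simp] theorem lift_adj (i : Fin n) : lift (adjTransposition n i) = σ i := by
  simpa using lift_mul_adj (one_lt_one_adj i)

@[simp] theorem inv_adj (i : Fin n) : inv (adjTransposition n i) = 1 := by
  simpa using inv_mul_adj (one_lt_one_adj i)

theorem len_lift (w : Perm (Fin (n + 1))) : len (lift w) = inv w := by
  induction w using ascent_induction with
  | one => simp
  | mul w i h ih => rw [lift_mul_adj h, len_mul, ih, len_σ, inv_mul_adj h]

theorem lift_mul {u v : Perm (Fin (n + 1))} (h : inv (u * v) = inv u + inv v) :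
    lift (u * v) = lift u * lift v := by
  induction v using ascent_induction with
  | one => simp
  | mul v i hi ih =>
    rw [inv_mul_adj hi, ← mul_assoc] at h
    have h1 := inv_mul_adj_le (u * v) i
    have h2 := inv_mul_le u v
    rw [← mul_assoc, lift_mul_adj (lt_of_inv_mul_adj (by omega)), lift_mul_adj hi,
      ih (by omega), mul_assoc]

/-- The projection to the symmetric group. -/
def toPerm : AbsBraidMonoid n →* Perm (Fin (n + 1)) :=
  PresentedMonoid.lift (adjTransposition n) (by
    rintro _ _ (⟨i, j, h⟩ | ⟨i, j, h⟩)
    · simpa using adj_mul_adj_of_far (.inl h)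
    · simpa using adj_mul_adj_of_adj (.inl h.symm))

@[simp] theorem toPerm_σ (i : Fin n) : toPerm (σ i) = adjTransposition n i := rfl

theorem inv_toPerm_le (x : AbsBraidMonoid n) : inv (toPerm x) ≤ len x := by
  induction x using σ_induction with
  | one => simp
  | mul i x ih =>
    have := inv_mul_le (adjTransposition n i) (toPerm x)
    rw [inv_adj] at this
    rw [map_mul, len_mul, toPerm_σ, len_σ]
    omega

theorem eq_lift_toPerm {x : AbsBraidMonoid n} (h : inv (toPerm x) = len x) :
    x = lift (toPerm x) := by
  induction x using σ_induction with
  | one => simp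
  | mul i x ih =>
    have h1 := inv_mul_le (adjTransposition n i) (toPerm x)
    have h2 := inv_toPerm_le x
    rw [map_mul, len_mul, toPerm_σ, len_σ] at h
    rw [inv_adj] at h1
    rw [map_mul, toPerm_σ, lift_mul (by rw [inv_adj]; omega), ← ih (by omega), lift_adj]

theorem toPerm_lift (w : Perm (Fin (n + 1))) : toPerm (lift w) = w := by
  induction w using ascent_induction with
  | one => simp
  | mul w i h ih => rw [lift_mul_adj h, map_mul, ih, toPerm_σ]

/-- The Garside element. -/
noncomputable def Δ : AbsBraidMonoid n := lift Fin.revPerm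

theorem lift_mul_lift_eq_Δ (w : Perm (Fin (n + 1))) :
    lift w * lift (w⁻¹ * Fin.revPerm) = Δ := by
  rw [← lift_mul, mul_inv_cancel_left, Δ]
  rw [mul_inv_cancel_left, inv_add_inv_mul_rev]

theorem dvd_Δ_iff {x : AbsBraidMonoid n} : x ∣ Δ ↔ ∃ w, x = lift w := by
  refine ⟨fun ⟨y, hy⟩ => ⟨toPerm x, eq_lift_toPerm ?_⟩, ?_⟩
  · have h1 := inv_mul_le (toPerm x) (toPerm y)
    have h2 := inv_toPerm_le x
    have h3 := inv_toPerm_le y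
    have h4 := congrArg len hy
    rw [← map_mul, ← hy, Δ, toPerm_lift] at h1
    rw [Δ, len_lift, len_mul] at h4
    omega
  · rintro ⟨w, rfl⟩
    exact ⟨_, (lift_mul_lift_eq_Δ w).symm⟩

theorem exists_mul_σ_eq_Δ (i : Fin n) :
    ∃ u, u * σ i = Δ ∧ σ i.rev * u = Δ := by
  have h1 := inv_add_inv_mul_rev (adjTransposition n i.rev)
  have h2 := lift_mul_lift_eq_Δ (adjTransposition n i.rev)
  have e : (adjTransposition n i.rev)⁻¹ * Fin.revPerm = Fin.revPerm * adjTransposition n i := by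
    rw [← adj_rev_mul_rev]; rfl
  rw [e] at h1 h2
  refine ⟨lift (Fin.revPerm * adjTransposition n i), ?_, by simpa using h2⟩
  rw [← lift_adj i, ← lift_mul] <;> rw [mul_assoc, adj_adj, mul_one]
  · rfl
  · rw [inv_adj, ← h1, inv_adj, add_comm]

theorem σ_rev_mul_Δ (i : Fin n) : σ i.rev * Δ = Δ * σ i := by
  obtain ⟨u, h1, h2⟩ := exists_mul_σ_eq_Δ i
  rw [← h1, ← mul_assoc, h2, h1]

theorem exists_Δ_mul (x : AbsBraidMonoid n) : ∃ x', Δ * x = x' * Δ := by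
  induction x using σ_induction with
  | one => exact ⟨1, by simp⟩
  | mul i x ih =>
    obtain ⟨x', h⟩ := ih
    exact ⟨σ i.rev * x', by rw [← mul_assoc, ← σ_rev_mul_Δ, mul_assoc, h, mul_assoc]⟩

theorem exists_mul_Δ (x : AbsBraidMonoid n) : ∃ x', x * Δ = Δ * x' := by
  induction x using σ_induction with
  | one => exact ⟨1, by simp⟩
  | mul i x ih =>
    obtain ⟨x', h⟩ := ih
    refine ⟨σ i.rev * x', ?_⟩
    rw [mul_assoc, h, ← mul_assoc, ← mul_assoc, ← σ_rev_mul_Δ i.rev, Fin.rev_rev]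

theorem exists_Δ_pow_mul (k : ℕ) (x : AbsBraidMonoid n) : ∃ x', Δ ^ k * x = x' * Δ ^ k := by
  induction k generalizing x with
  | zero => exact ⟨x, by simp⟩
  | succ k ih =>
    obtain ⟨y, hy⟩ := exists_Δ_mul x
    obtain ⟨z, hz⟩ := ih y
    exact ⟨z, by rw [pow_succ, mul_assoc, hy, ← mul_assoc, hz, mul_assoc]⟩

theorem exists_mul_eq_Δ_pow (x : AbsBraidMonoid n) : ∃ k y, y * x = Δ ^ k := by
  induction x using σ_induction with
  | one => exact ⟨0, 1, by simp⟩
  | mul i x ih =>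
    obtain ⟨k, y, h⟩ := ih
    obtain ⟨u, hu, -⟩ := exists_mul_σ_eq_Δ i
    obtain ⟨z, hz⟩ := exists_Δ_mul y
    exact ⟨k + 1, z * u, by rw [mul_assoc, ← mul_assoc u, hu, ← mul_assoc, ← hz, mul_assoc, h,
      pow_succ']⟩

theorem exists_ore (r s : AbsBraidMonoid n) : ∃ d m, d * r = m * s := by
  obtain ⟨k, y, h⟩ := exists_mul_eq_Δ_pow s
  obtain ⟨r', hr⟩ := exists_Δ_pow_mul k r
  exact ⟨Δ ^ k, r' * y, by rw [hr, ← h, mul_assoc]⟩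

noncomputable instance : OreLocalization.OreSet (⊤ : Submonoid (AbsBraidMonoid n)) where
  ore_right_cancel r₁ r₂ s h := ⟨1, by rw [mul_right_cancel h]⟩
  oreNum r s := (exists_ore r s).choose_spec.choose
  oreDenom r s := ⟨(exists_ore r s).choose, trivial⟩
  ore_eq r s := (exists_ore r s).choose_spec.choose_spec

/-- The embedding of the positive braid monoid into its group of fractions. -/
noncomputable def toFrac :
    AbsBraidMonoid n →*
      (OreLocalization (⊤ : Submonoid (AbsBraidMonoid n)) (AbsBraidMonoid n))ˣ where
  toFun x := OreLocalization.numeratorUnit ⟨x, trivial⟩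
  map_one' := Units.ext (map_one OreLocalization.numeratorHom)
  map_mul' x y := Units.ext (map_mul OreLocalization.numeratorHom x y)

theorem toFrac_injective : Function.Injective (toFrac (n := n)) := by
  intro x y h
  have h' := congrArg Units.val h
  obtain ⟨u, v, h1, h2⟩ := OreLocalization.oreDiv_eq_iff.mp h'
  simp only [OneMemClass.coe_one, mul_one] at h2
  rw [← h2] at h1
  exact (mul_left_cancel h1).symm

/-- The canonical map to the braid group. -/
def toGroup : AbsBraidMonoid n →* BraidGroup n :=
  PresentedMonoid.lift (PresentedGroup.of (rels := braidRels n)) (by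
    rintro _ _ (⟨i, j, h⟩ | ⟨i, j, h⟩)
    · have := PresentedGroup.one_of_mem (rels := braidRels n) (.inl ⟨i, j, h, rfl⟩)
      simp only [map_mul, map_inv, mul_inv_eq_iff_eq_mul, one_mul] at this
      simp only [map_mul, FreeMonoid.lift_eval_of]
      exact this
    · have := PresentedGroup.one_of_mem (rels := braidRels n) (.inr ⟨i, j, h, rfl⟩)
      simp only [map_mul, map_inv, mul_inv_eq_one] at this
      simp only [map_mul, FreeMonoid.lift_eval_of]
      exact this)

@[simp] theorem toGroup_σ (i : Fin n) : toGroup (σ i) = PresentedGroup.of i := rfl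

/-- The positive braid monoid embeds in the braid group. -/
theorem toGroup_injective : Function.Injective (toGroup (n := n)) := by
  have hrel : ∀ r ∈ braidRels n, FreeGroup.lift (fun i => toFrac (σ i)) r = 1 := by
    rintro _ (⟨i, j, h, rfl⟩ | ⟨i, j, h, rfl⟩)
    · simp only [map_mul, map_inv, FreeGroup.lift_apply_of, mul_inv_eq_iff_eq_mul, one_mul]
      rw [← map_mul, ← map_mul, σ_far (.inl h)]
    · simp only [map_mul, map_inv, FreeGroup.lift_apply_of, mul_inv_eq_one]
      simp only [← map_mul, mul_assoc, σ_adj (.inl h.symm)]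
  have hcomp : (PresentedGroup.toGroup hrel).comp toGroup = toFrac :=
    PresentedMonoid.ext _ fun i => by
      change PresentedGroup.toGroup hrel (PresentedGroup.of i) = _
      rw [PresentedGroup.toGroup.of]; rfl
  refine Function.Injective.of_comp (f := PresentedGroup.toGroup hrel) ?_
  rw [← MonoidHom.coe_comp, hcomp]
  exact toFrac_injective

theorem mrange_toGroup : MonoidHom.mrange (toGroup (n := n)) = posBraidMonoid n := by
  rw [MonoidHom.mrange_eq_map, ← PresentedMonoid.closure_range_of, MonoidHom.map_mclosure,
    ← Set.range_comp]
  rfl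

theorem eq_of_dvd_of_len_le {a b : AbsBraidMonoid n} (h₁ : a ∣ b) (h₂ : len b ≤ len a) : a = b := by
  obtain ⟨c, rfl⟩ := h₁
  rw [len_mul] at h₂
  rw [eq_one_of_len_eq_zero (x := c) (by omega), mul_one]

theorem len_le_of_dvd {a b : AbsBraidMonoid n} (h : a ∣ b) : len a ≤ len b := by
  obtain ⟨c, rfl⟩ := h
  simp

/-- A simple left divisor of `x` of maximal length is divisible by every simple left divisor. -/
theorem dvd_lift_of_maximal {x s : AbsBraidMonoid n} {w : Perm (Fin (n + 1))} (hw : lift w ∣ x)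
    (hmax : ∀ v, lift v ∣ x → inv v ≤ inv w) (hs : s ∣ Δ) (hsx : s ∣ x) : s ∣ lift w := by
  obtain ⟨t, hst, hwt, ht⟩ := exists_lcm hsx hw
  obtain ⟨v, rfl⟩ := dvd_Δ_iff.mp (ht Δ hs (dvd_Δ_iff.mpr ⟨w, rfl⟩))
  have := hmax v (ht x hsx hw)
  rw [← len_lift, ← len_lift] at this
  rwa [eq_of_dvd_of_len_le hwt this]

/-- The simple left divisors of `x * y` depend only on `x` and the simple left divisors of `y`. -/
theorem dvd_mul_of_dvd_mul {x y s l : AbsBraidMonoid n} (hl : ∀ s, s ∣ Δ → s ∣ y → s ∣ l)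
    (hs : s ∣ Δ) (h : s ∣ x * y) : s ∣ x * l := by
  obtain ⟨t, hst, ⟨t', rfl⟩, ht⟩ := exists_lcm h (dvd_mul_right x y)
  obtain ⟨x', hx'⟩ := exists_mul_Δ x
  have h1 : x * t' ∣ x * Δ := ht _ (hx' ▸ hs.mul_right _) (dvd_mul_right _ _)
  have h2 : x * t' ∣ x * y := ht _ h (dvd_mul_right _ _)
  exact hst.trans (mul_dvd_mul_left _
    (hl t' (dvd_of_left_mul_dvd_left_mul h1) (dvd_of_left_mul_dvd_left_mul h2)))

end AbsBraidMonoid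

open AbsBraidMonoid Equiv.Perm in
/-- The leftmost-factor map defines a monoid action: if `r : S_{n+1} → B_{n+1}` is the
canonical section and `LF` sends a positive braid `x` to `r x'` where `x'` is the unique
longest permutation with `x ∈ r(x') B_{n+1}^+`, then `LF(xy) = LF(x · LF(y))` for all
positive braids `x, y`; consequently `(x, w) ↦ LF(x w)` is an action of the monoid
`B_{n+1}^+` on the finite set `Ω = r(S_{n+1})`: `LF(1 · w) = w` for `w ∈ Ω` and
`LF((xy) w) = LF(x · LF(y w))`. -/
theorem leftmost_factor_action (n : ℕ)
    (r : Equiv.Perm (Fin (n + 1)) → BraidGroup n)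
    (hr1 : ∀ i : Fin n, r (adjTransposition n i) = PresentedGroup.of i)
    (hr2 : ∀ x y : Equiv.Perm (Fin (n + 1)),
      wordLen n (x * y) = wordLen n x + wordLen n y → r (x * y) = r x * r y)
    (LF : BraidGroup n → BraidGroup n)
    (hLF : ∀ x ∈ posBraidMonoid n, ∃ x' : Equiv.Perm (Fin (n + 1)),
      LF x = r x' ∧ (∃ z ∈ posBraidMonoid n, x = r x' * z) ∧
      ∀ y' : Equiv.Perm (Fin (n + 1)),
        (∃ z ∈ posBraidMonoid n, x = r y' * z) → wordLen n y' ≤ wordLen n x') :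
    (∀ x ∈ posBraidMonoid n, ∀ y ∈ posBraidMonoid n, LF (x * y) = LF (x * LF y)) ∧
    (∀ w ∈ Set.range r, LF ((1 : BraidGroup n) * w) = w) ∧
    (∀ x ∈ posBraidMonoid n, ∀ y ∈ posBraidMonoid n, ∀ w ∈ Set.range r,
      LF (x * y * w) = LF (x * LF (y * w))) := by
  have hr : ∀ w, r w = toGroup (lift w) := by
    intro w
    induction w using ascent_induction with
    | one => simpa [wordLen_eq_inv] using hr2 1 1
    | mul w i h ih =>
      rw [hr2 _ _ (by simp [wordLen_eq_inv, inv_mul_adj h]), ih, hr1, lift_mul_adj h, map_mul,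
        toGroup_σ]
  have hmem : ∀ x, x ∈ posBraidMonoid n ↔ ∃ a, toGroup a = x := fun x => by
    rw [← mrange_toGroup, MonoidHom.mem_mrange]
  have hdvd : ∀ w a, (∃ z ∈ posBraidMonoid n, toGroup a = r w * z) ↔ lift w ∣ a := by
    intro w a
    constructor
    · rintro ⟨z, hz, h⟩
      obtain ⟨c, rfl⟩ := (hmem z).mp hz
      rw [hr, ← map_mul] at h
      exact ⟨c, toGroup_injective h⟩
    · rintro ⟨c, rfl⟩
      exact ⟨toGroup c, (hmem _).mpr ⟨c, rfl⟩, by rw [map_mul, hr]⟩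
  have spec : ∀ a, ∃ w, LF (toGroup a) = toGroup (lift w) ∧ lift w ∣ a ∧
      ∀ s, s ∣ Δ → s ∣ a → s ∣ lift w := by
    intro a
    obtain ⟨w, h1, h2, h3⟩ := hLF (toGroup a) ((hmem _).mpr ⟨a, rfl⟩)
    simp only [hdvd, wordLen_eq_inv] at h2 h3
    exact ⟨w, by rw [h1, hr], h2, fun s => dvd_lift_of_maximal h2 h3⟩
  have simple (w : Equiv.Perm (Fin (n + 1))) : lift w ∣ Δ := dvd_Δ_iff.mpr ⟨w, rfl⟩
  have main : ∀ x ∈ posBraidMonoid n, ∀ y ∈ posBraidMonoid n, LF (x * y) = LF (x * LF y) := by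
    intro x hx y hy
    obtain ⟨a, rfl⟩ := (hmem x).mp hx
    obtain ⟨b, rfl⟩ := (hmem y).mp hy
    obtain ⟨w, hw, hwb, hwmax⟩ := spec b
    rw [hw, ← map_mul, ← map_mul]
    obtain ⟨u, hu, hua, humax⟩ := spec (a * b)
    obtain ⟨v, hv, hva, hvmax⟩ := spec (a * lift w)
    have huv := hvmax _ (simple u) (dvd_mul_of_dvd_mul hwmax (simple u) hua)
    have hvu := humax _ (simple v) (hva.trans (mul_dvd_mul_left a hwb))
    rw [hu, hv, eq_of_dvd_of_len_le huv (len_le_of_dvd hvu)]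
  have hrange : ∀ w ∈ Set.range r, w ∈ posBraidMonoid n := by
    rintro _ ⟨w, rfl⟩
    exact (hmem _).mpr ⟨lift w, (hr w).symm⟩
  refine ⟨main, ?_, fun x hx y hy w hw => ?_⟩
  · rintro _ ⟨w, rfl⟩
    rw [one_mul, hr]
    obtain ⟨u, hu, huw, humax⟩ := spec (lift w)
    rw [hu, eq_of_dvd_of_len_le huw (len_le_of_dvd (humax _ (simple w) dvd_rfl))]
  · rw [mul_assoc]
    exact main x hx _ (mul_mem hy (hrange w hw))
end
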